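/- arXiv:1907.09950 — 4 statements merged into one kernel-verified Lean document; each statement's English description precedes it below -/
import Mathlib

section
/- Let G be a graph and let Γ be a subgroup of the automorphism group Aut(G) such that |Γ·e| = |Γ| for every edge e ∈ E(G), where Γ·e = {φ(e) : φ ∈ Γ} is the orbit of e. Suppose that H is a subgraph of G that is rainbow with respect to the orbit colouring c_o^Γ (which colours each edge e by its orbit Γ·e). Then the subgraphs φ(H), for φ ∈ Γ, are pairwise edge-disjoint subgraphs of G, each isomorphic to H; i.e., {φ(H)}_{φ∈Γ} is a Γ-generated H-packing in G. -/
open Finset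
open scoped Classical

noncomputable section

/-- The orbit of an edge `e` under a subgroup `Γ` of permutations. -/
def edgeOrbit {V : Type*} (Γ : Subgroup (Equiv.Perm V)) (e : Sym2 V) : Set (Sym2 V) :=
  {f | ∃ φ ∈ Γ, Sym2.map (⇑φ) e = f}

theorem map_mem_edgeOrbit {V : Type*} {Γ : Subgroup (Equiv.Perm V)} {φ : Equiv.Perm V}
    (hφ : φ ∈ Γ) (e : Sym2 V) : Sym2.map (⇑φ) e ∈ edgeOrbit Γ e :=
  ⟨φ, hφ, rfl⟩

theorem edgeOrbit_map {V : Type*} {Γ : Subgroup (Equiv.Perm V)} {φ : Equiv.Perm V}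
    (hφ : φ ∈ Γ) (e : Sym2 V) : edgeOrbit Γ (Sym2.map (⇑φ) e) = edgeOrbit Γ e := by
  ext f
  constructor
  · rintro ⟨ψ, hψ, rfl⟩
    exact ⟨ψ * φ, Γ.mul_mem hψ hφ, by rw [Sym2.map_map, Equiv.Perm.coe_mul]⟩
  · rintro ⟨ψ, hψ, rfl⟩
    refine ⟨ψ * φ⁻¹, Γ.mul_mem hψ (Γ.inv_mem hφ), ?_⟩
    rw [Sym2.map_map, ← Equiv.Perm.coe_mul, inv_mul_cancel_right]

/-- If the orbit of `e` is as large as the finite group `Γ`, then `e` has trivial stabilizer. -/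
theorem eq_of_map_eq_map {V : Type*} {Γ : Subgroup (Equiv.Perm V)} [Finite Γ] {e : Sym2 V}
    (he : (edgeOrbit Γ e).ncard = Nat.card Γ) {φ ψ : Equiv.Perm V} (hφ : φ ∈ Γ) (hψ : ψ ∈ Γ)
    (h : Sym2.map (⇑φ) e = Sym2.map (⇑ψ) e) : φ = ψ := by
  let f : Γ → edgeOrbit Γ e := fun χ => ⟨Sym2.map (⇑χ.1) e, map_mem_edgeOrbit χ.2 e⟩
  have hsurj : Function.Surjective f := by
    rintro ⟨_, χ, hχ, rfl⟩
    exact ⟨⟨χ, hχ⟩, rfl⟩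
  have hbij : Function.Bijective f :=
    (Nat.bijective_iff_surjective_and_card f).mpr
      ⟨hsurj, by rw [← he, Nat.card_coe_set_eq]⟩
  have heq : (⟨φ, hφ⟩ : Γ) = ⟨ψ, hψ⟩ := hbij.injective (Subtype.ext h)
  exact congrArg Subtype.val heq

/-- **Lemma (packings from rainbow subgraphs with respect to the orbit colouring).**
Let `G` be a graph, `Γ ≤ Aut(G)` with `|Γ·e| = |Γ|` for every edge `e`, and let `H ≤ G`
be a subgraph that is rainbow with respect to the orbit colouring (distinct edges of `H`
lie in distinct orbits).  Then the images `φ(H)`, `φ ∈ Γ`, are subgraphs of `G`, each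
isomorphic to `H`, and pairwise edge-disjoint: a `Γ`-generated `H`-packing in `G`. -/
theorem orbit_rainbow_packing {V : Type*} [Fintype V] (G H : SimpleGraph V) (hHG : H ≤ G)
    (Γ : Subgroup (Equiv.Perm V))
    (haut : ∀ φ ∈ Γ, ∀ u v : V, G.Adj (φ u) (φ v) ↔ G.Adj u v)
    (horb : ∀ e ∈ G.edgeSet, (edgeOrbit Γ e).ncard = Nat.card Γ)
    (hrainbow : ∀ e ∈ H.edgeSet, ∀ e' ∈ H.edgeSet,
      edgeOrbit Γ e = edgeOrbit Γ e' → e = e') :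
    (∀ φ ∈ Γ, H.map (Equiv.toEmbedding φ) ≤ G) ∧
    (∀ φ ∈ Γ, Nonempty (H.map (Equiv.toEmbedding φ) ≃g H)) ∧
    (∀ φ ∈ Γ, ∀ ψ ∈ Γ, φ ≠ ψ →
      Disjoint (H.map (Equiv.toEmbedding φ)).edgeSet
        (H.map (Equiv.toEmbedding ψ)).edgeSet) := by
  refine ⟨?_, fun φ _ => ⟨(SimpleGraph.Iso.map φ H).symm⟩, ?_⟩
  · rintro φ hφ _ _ ⟨_, u, v, huv, rfl, rfl⟩
    exact (haut φ hφ u v).mpr (hHG huv)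
  · intro φ hφ ψ hψ hne
    rw [Set.disjoint_left]
    intro f hf hf'
    rw [SimpleGraph.edgeSet_map] at hf hf'
    obtain ⟨e, he, rfl⟩ := hf
    obtain ⟨e', he', h⟩ := hf'
    change Sym2.map (⇑ψ) e' = Sym2.map (⇑φ) e at h
    obtain rfl : e' = e := hrainbow e' he' e he <| by
      rw [← edgeOrbit_map hψ, h, edgeOrbit_map hφ]
    exact hne (eq_of_map_eq_map (horb e' (SimpleGraph.edgeSet_mono hHG he')) hφ hψ h.symm)
end
end

section
/- For all d ∈ (0,1] and Λ ∈ ℕ, there exist ε₀ > 0 and, for each ε ≤ ε₀, an n₀ ∈ ℕ such that the following holds for all n ≥ n₀. Suppose G is an (ε,d)-super-regular bipartite graph with vertex partition (A,B), |A|, |B| = (1±ε)n, and c : E(G) → C is a locally Λ-bounded edge-colouring of G. Call a pair of distinct vertices u, v ∈ A good if |N_G(u) ∩ N_G(v)| = (d±ε)²|B| and |{w ∈ N_G(u) ∩ N_G(v) : c(uw) = c(vw)}| ≤ ε|B|. Then there are at least (1-7ε)|A|²/2 good pairs u, v ∈ A. -/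
open Finset
open scoped Classical

noncomputable section

variable {V C : Type*}

/-- Number of edges of `G` between `S` and `T`, counted as ordered pairs. -/
def eB [Fintype V] (G : SimpleGraph V) (S T : Finset V) : ℕ :=
  ((S ×ˢ T).filter fun p => G.Adj p.1 p.2).card

/-- The pair `(A,B)` is `(ε,d)`-regular in `G`. -/
def RegularPair [Fintype V] (G : SimpleGraph V) (A B : Finset V) (ε d : ℝ) : Prop :=
  ∀ S ⊆ A, ∀ T ⊆ B, ε * A.card ≤ S.card → ε * B.card ≤ T.card →
    |((eB G S T : ℝ) / (S.card * T.card)) - d| ≤ ε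

/-- The pair `(A,B)` is `(ε,d)`-super-regular in `G`. -/
def SuperRegularPair [Fintype V] (G : SimpleGraph V) (A B : Finset V) (ε d : ℝ) : Prop :=
  RegularPair G A B ε d ∧
  (∀ a ∈ A, |((eB G {a} B : ℝ)) - d * B.card| ≤ ε * B.card) ∧
  (∀ b ∈ B, |((eB G A {b} : ℝ)) - d * A.card| ≤ ε * A.card)

/-- The colouring `c` is locally `Λ`-bounded. -/
def LocallyBounded [Fintype V] (G : SimpleGraph V) (c : Sym2 V → C) (Λ : ℕ) : Prop :=
  ∀ (v : V) (α : C), ((Finset.univ.filter fun u => G.Adj v u ∧ c s(v, u) = α).card) ≤ Λ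

/-- A pair `u ≠ v` in `A` is good if the common neighbourhood has size `(d±ε)²|B|` and at
most `ε|B|` common neighbours `w` see the same colour on `uw` and `vw`. -/
def GoodPair [Fintype V] (G : SimpleGraph V) (B : Finset V) (c : Sym2 V → C)
    (ε d : ℝ) (u v : V) : Prop :=
  ((d - ε) ^ 2 * B.card ≤ ((Finset.univ.filter fun w => G.Adj u w ∧ G.Adj v w).card : ℝ)) ∧
  (((Finset.univ.filter fun w => G.Adj u w ∧ G.Adj v w).card : ℝ) ≤ (d + ε) ^ 2 * B.card) ∧
  (((Finset.univ.filter fun w =>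
      G.Adj u w ∧ G.Adj v w ∧ c s(u, w) = c s(v, w)).card : ℝ) ≤ ε * B.card)

/-- Edge counts into a neighbourhood are sums of codegrees. -/
lemma eB_neighborhood [Fintype V] (G : SimpleGraph V) (S : Finset V) (u : V) :
    eB G S (univ.filter fun w => G.Adj u w) =
      ∑ v ∈ S, (univ.filter fun w => G.Adj u w ∧ G.Adj v w).card := by
  unfold eB
  rw [card_filter, sum_product]
  refine sum_congr rfl fun v _ => ?_
  rw [← card_filter, filter_filter]

lemma eB_singleton_left [Fintype V] (G : SimpleGraph V) (B : Finset V) (u : V)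
    (hB : ∀ w, G.Adj u w → w ∈ B) :
    eB G {u} B = (univ.filter fun w => G.Adj u w).card := by
  unfold eB
  rw [card_filter, sum_product, sum_singleton, ← card_filter]
  congr 1
  ext w
  simp only [mem_filter, mem_univ, true_and, and_iff_right_iff_imp]
  exact hB w

/-- In a regular pair, few vertices have a too large common neighbourhood with `u`. -/
lemma card_large_codegree_le [Fintype V] {G : SimpleGraph V} {A B : Finset V} {ε d : ℝ}
    (hε : 0 < ε) (hd : 2 * ε ≤ d) (hA : 0 < A.card) (hB : 0 < B.card)
    (hreg : RegularPair G A B ε d) {u : V} (hu : ∀ w, G.Adj u w → w ∈ B)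
    (hdeg : |((univ.filter fun w => G.Adj u w).card : ℝ) - d * B.card| ≤ ε * B.card) :
    ((A.filter fun v => (d + ε) ^ 2 * B.card <
      ((univ.filter fun w => G.Adj u w ∧ G.Adj v w).card : ℝ)).card : ℝ) ≤ ε * A.card := by
  by_contra! h
  set S := A.filter fun v => (d + ε) ^ 2 * B.card <
      ((univ.filter fun w => G.Adj u w ∧ G.Adj v w).card : ℝ) with hS
  set T := univ.filter fun w => G.Adj u w with hT
  have hAR : (0 : ℝ) < A.card := by exact_mod_cast hA
  have hBR : (0 : ℝ) < B.card := by exact_mod_cast hB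
  obtain ⟨h1, h2⟩ := abs_le.1 hdeg
  have hTB : T ⊆ B := fun w hw => hu w (mem_filter.1 hw).2
  have hTc : ε * B.card ≤ T.card := by nlinarith
  have hTpos : (0 : ℝ) < T.card := (mul_pos hε hBR).trans_le hTc
  have hSpos : (0 : ℝ) < S.card := (mul_pos hε hAR).trans h
  have hr := (abs_le.1 (hreg S (filter_subset _ _) T hTB h.le hTc)).2
  have hle : (eB G S T : ℝ) ≤ (d + ε) * (S.card * T.card) := by
    rw [← div_le_iff₀ (mul_pos hSpos hTpos)]
    linarith
  have hSne : S.Nonempty := card_pos.1 (by exact_mod_cast hSpos)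
  have hlt : (S.card : ℝ) * ((d + ε) ^ 2 * B.card) < eB G S T := by
    rw [eB_neighborhood, ← nsmul_eq_mul, ← sum_const]
    push_cast
    exact sum_lt_sum_of_nonempty hSne fun v hv => (mem_filter.1 hv).2
  have hT2 : (T.card : ℝ) ≤ (d + ε) * B.card := by linarith
  have := mul_le_mul_of_nonneg_left hT2 (mul_nonneg (by linarith : 0 ≤ d + ε) hSpos.le)
  nlinarith

/-- In a regular pair, few vertices have a too small common neighbourhood with `u`. -/
lemma card_small_codegree_le [Fintype V] {G : SimpleGraph V} {A B : Finset V} {ε d : ℝ}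
    (hε : 0 < ε) (hd : 2 * ε ≤ d) (hA : 0 < A.card) (hB : 0 < B.card)
    (hreg : RegularPair G A B ε d) {u : V} (hu : ∀ w, G.Adj u w → w ∈ B)
    (hdeg : |((univ.filter fun w => G.Adj u w).card : ℝ) - d * B.card| ≤ ε * B.card) :
    ((A.filter fun v => ((univ.filter fun w => G.Adj u w ∧ G.Adj v w).card : ℝ) <
      (d - ε) ^ 2 * B.card).card : ℝ) ≤ ε * A.card := by
  by_contra! h
  set S := A.filter fun v => ((univ.filter fun w => G.Adj u w ∧ G.Adj v w).card : ℝ) <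
      (d - ε) ^ 2 * B.card with hS
  set T := univ.filter fun w => G.Adj u w with hT
  have hAR : (0 : ℝ) < A.card := by exact_mod_cast hA
  have hBR : (0 : ℝ) < B.card := by exact_mod_cast hB
  obtain ⟨h1, h2⟩ := abs_le.1 hdeg
  have hTB : T ⊆ B := fun w hw => hu w (mem_filter.1 hw).2
  have hTc : ε * B.card ≤ T.card := by nlinarith
  have hTpos : (0 : ℝ) < T.card := (mul_pos hε hBR).trans_le hTc
  have hSpos : (0 : ℝ) < S.card := (mul_pos hε hAR).trans h
  have hr := (abs_le.1 (hreg S (filter_subset _ _) T hTB h.le hTc)).1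
  have hle : (d - ε) * (S.card * T.card) ≤ (eB G S T : ℝ) := by
    rw [← le_div_iff₀ (mul_pos hSpos hTpos)]
    linarith
  have hSne : S.Nonempty := card_pos.1 (by exact_mod_cast hSpos)
  have hlt : (eB G S T : ℝ) < S.card * ((d - ε) ^ 2 * B.card) := by
    rw [eB_neighborhood, ← nsmul_eq_mul, ← sum_const]
    push_cast
    exact sum_lt_sum_of_nonempty hSne fun v hv => (mem_filter.1 hv).2
  have hT2 : (d - ε) * B.card ≤ (T.card : ℝ) := by linarith
  have := mul_le_mul_of_nonneg_left hT2 (mul_nonneg (by linarith : 0 ≤ d - ε) hSpos.le)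
  nlinarith

/-- In a locally bounded colouring, few vertices see many monochromatic cherries with `u`. -/
lemma card_many_monochromatic_le [Fintype V] {G : SimpleGraph V} {A B : Finset V}
    {c : Sym2 V → C} {Λ : ℕ} {ε : ℝ} (hε : 0 < ε) (hB : 0 < B.card)
    (hc : LocallyBounded G c Λ) {u : V} (hu : ∀ w, G.Adj u w → w ∈ B) :
    ((A.filter fun v => ε * B.card < ((univ.filter fun w =>
      G.Adj u w ∧ G.Adj v w ∧ c s(u, w) = c s(v, w)).card : ℝ)).card : ℝ) ≤ Λ / ε := by
  set S := A.filter fun v => ε * B.card < ((univ.filter fun w =>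
      G.Adj u w ∧ G.Adj v w ∧ c s(u, w) = c s(v, w)).card : ℝ) with hS
  have hBR : (0 : ℝ) < B.card := by exact_mod_cast hB
  have hlow : (S.card : ℝ) * (ε * B.card) ≤ ∑ v ∈ S, ((univ.filter fun w =>
      G.Adj u w ∧ G.Adj v w ∧ c s(u, w) = c s(v, w)).card : ℝ) := by
    rw [← nsmul_eq_mul, ← sum_const]
    exact sum_le_sum fun v hv => (mem_filter.1 hv).2.le
  have hup : ∑ v ∈ S, (univ.filter fun w =>
      G.Adj u w ∧ G.Adj v w ∧ c s(u, w) = c s(v, w)).card ≤ B.card * Λ := by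
    calc _ = ∑ v ∈ S, (B.filter fun w =>
          G.Adj u w ∧ G.Adj v w ∧ c s(u, w) = c s(v, w)).card := by
          refine sum_congr rfl fun v _ => congrArg card ?_
          ext w
          simp only [mem_filter, mem_univ, true_and]
          exact ⟨fun h => ⟨hu w h.1, h⟩, fun h => h.2⟩
      _ = ∑ w ∈ B, (S.filter fun v =>
          G.Adj u w ∧ G.Adj v w ∧ c s(u, w) = c s(v, w)).card :=
          sum_card_bipartiteAbove_eq_sum_card_bipartiteBelow
            (fun v w => G.Adj u w ∧ G.Adj v w ∧ c s(u, w) = c s(v, w))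
      _ ≤ ∑ w ∈ B, Λ := by
          refine sum_le_sum fun w _ => (card_le_card fun v hv => ?_).trans (hc w (c s(u, w)))
          obtain ⟨-, -, hvw, hcol⟩ := mem_filter.1 hv
          exact mem_filter.2 ⟨mem_univ _, hvw.symm, by rw [Sym2.eq_swap, hcol]⟩
      _ = B.card * Λ := by simp
  have hup' : ∑ v ∈ S, ((univ.filter fun w =>
      G.Adj u w ∧ G.Adj v w ∧ c s(u, w) = c s(v, w)).card : ℝ) ≤ B.card * Λ := by
    exact_mod_cast hup
  rw [le_div_iff₀ hε]
  refine le_of_mul_le_mul_right ?_ hBR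
  linarith

/-- Identifying ordered pairs with their swaps at most halves the number of pairs. -/
lemma card_le_two_mul_card_image_sym2 {α : Type*} (S : Finset (α × α)) :
    S.card ≤ 2 * (S.image fun p => s(p.1, p.2)).card := by
  refine card_le_mul_card_image S 2 fun e _ => ?_
  induction e using Sym2.ind with
  | _ x y =>
    refine (card_le_card (t := {(x, y), (y, x)}) fun p hp => ?_).trans card_le_two
    obtain ⟨-, h⟩ := mem_filter.1 hp
    obtain ⟨a, b⟩ := p
    simpa [Sym2.eq_iff] using h

/-- Every vertex of `A` forms a bad pair with few vertices of `A`. -/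
lemma card_bad_partners_le [Fintype V] {G : SimpleGraph V} {A B : Finset V}
    {c : Sym2 V → C} {Λ : ℕ} {ε d : ℝ} (hε : 0 < ε) (hd : 2 * ε ≤ d)
    (hA : 0 < A.card) (hB : 0 < B.card) (hreg : RegularPair G A B ε d)
    (hc : LocallyBounded G c Λ) {u : V} (hu : ∀ w, G.Adj u w → w ∈ B)
    (hdeg : |((univ.filter fun w => G.Adj u w).card : ℝ) - d * B.card| ≤ ε * B.card) :
    ((A.filter fun v => ¬(u ≠ v ∧ GoodPair G B c ε d u v)).card : ℝ) ≤
      2 * ε * A.card + Λ / ε + 1 := by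
  have h1 := card_large_codegree_le hε hd hA hB hreg hu hdeg
  have h2 := card_small_codegree_le hε hd hA hB hreg hu hdeg
  have h3 := card_many_monochromatic_le (A := A) hε hB hc hu
  set S₁ := A.filter fun v => (d + ε) ^ 2 * B.card <
      ((univ.filter fun w => G.Adj u w ∧ G.Adj v w).card : ℝ) with hS₁
  set S₂ := A.filter fun v => ((univ.filter fun w => G.Adj u w ∧ G.Adj v w).card : ℝ) <
      (d - ε) ^ 2 * B.card with hS₂
  set S₃ := A.filter fun v => ε * B.card < ((univ.filter fun w =>
      G.Adj u w ∧ G.Adj v w ∧ c s(u, w) = c s(v, w)).card : ℝ) with hS₃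
  have hsub : (A.filter fun v => ¬(u ≠ v ∧ GoodPair G B c ε d u v)) ⊆
      ((S₁ ∪ S₂) ∪ S₃) ∪ {u} := by
    intro v hv
    obtain ⟨hvA, hbad⟩ := mem_filter.1 hv
    by_contra hn
    simp only [mem_union, mem_singleton, not_or] at hn
    obtain ⟨⟨⟨n1, n2⟩, n3⟩, n4⟩ := hn
    refine hbad ⟨fun h => n4 h.symm, ?_, ?_, ?_⟩
    · by_contra! h
      exact n2 (mem_filter.2 ⟨hvA, h⟩)
    · by_contra! h
      exact n1 (mem_filter.2 ⟨hvA, h⟩)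
    · by_contra! h
      exact n3 (mem_filter.2 ⟨hvA, h⟩)
  have hcard : (A.filter fun v => ¬(u ≠ v ∧ GoodPair G B c ε d u v)).card ≤
      S₁.card + S₂.card + S₃.card + 1 := by
    refine (card_le_card hsub).trans ((card_union_le _ _).trans ?_)
    have := card_union_le (S₁ ∪ S₂) S₃
    have := card_union_le S₁ S₂
    rw [card_singleton]
    omega
  have hcard' : ((A.filter fun v => ¬(u ≠ v ∧ GoodPair G B c ε d u v)).card : ℝ) ≤
      S₁.card + S₂.card + S₃.card + 1 := by exact_mod_cast hcard
  linarith

/-- **Claim (most pairs are good).**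
In an `(ε,d)`-super-regular bipartite graph with a locally `Λ`-bounded colouring, at
least `(1-7ε)|A|²/2` (unordered) pairs of distinct vertices of `A` are good. -/
theorem most_pairs_good (d : ℝ) (hd0 : 0 < d) (hd1 : d ≤ 1) (Λ : ℕ) :
    ∃ ε₀ > (0 : ℝ), ∀ ε : ℝ, 0 < ε → ε ≤ ε₀ →
    ∃ n₀ : ℕ, ∀ n : ℕ, n₀ ≤ n →
    ∀ (V C : Type) [Fintype V],
    ∀ (G : SimpleGraph V) (A B : Finset V),
      Disjoint A B → A ∪ B = Finset.univ →
      (∀ u v, G.Adj u v → (u ∈ A ∧ v ∈ B) ∨ (u ∈ B ∧ v ∈ A)) →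
      |(A.card : ℝ) - n| ≤ ε * n → |(B.card : ℝ) - n| ≤ ε * n →
      SuperRegularPair G A B ε d →
      ∀ (c : Sym2 V → C), LocallyBounded G c Λ →
      (1 - 7 * ε) * (A.card : ℝ) ^ 2 / 2 ≤
        ((((A ×ˢ A).filter fun p =>
            p.1 ≠ p.2 ∧ GoodPair G B c ε d p.1 p.2).image fun p => s(p.1, p.2)).card : ℝ) := by
  refine ⟨d / 2, by linarith, fun ε hε hεd => ?_⟩
  refine ⟨⌈2 * (Λ / ε + 1) / ε⌉₊ + 1, ?_⟩
  intro n hn V C _ G A B hdisj _ hbip hAn hBn hsuper c hc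
  obtain ⟨hreg, hdegA, -⟩ := hsuper
  have hnR : 2 * (Λ / ε + 1) / ε ≤ n :=
    (Nat.le_ceil _).trans (by exact_mod_cast (Nat.le_succ _).trans hn)
  rw [div_le_iff₀ hε] at hnR
  have hn1 : (1 : ℝ) ≤ n := by exact_mod_cast (Nat.le_add_left 1 _).trans hn
  have hA2 : (n : ℝ) / 2 ≤ A.card := by nlinarith [(abs_le.1 hAn).1]
  have hB2 : (n : ℝ) / 2 ≤ B.card := by nlinarith [(abs_le.1 hBn).1]
  have hA : 0 < A.card := by
    have : (0 : ℝ) < A.card := by linarith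
    exact_mod_cast this
  have hB : 0 < B.card := by
    have : (0 : ℝ) < B.card := by linarith
    exact_mod_cast this
  have hAΛ : Λ / ε + 1 ≤ ε * A.card := by nlinarith
  have hrow : ∀ u ∈ A, (1 - 7 * ε) * (A.card : ℝ) ≤
      ((A.filter fun v => u ≠ v ∧ GoodPair G B c ε d u v).card : ℝ) := by
    intro u huA
    have hu : ∀ w, G.Adj u w → w ∈ B := fun w hw => (hbip u w hw).elim And.right
      fun h => absurd h.1 (disjoint_left.1 hdisj huA)
    have hdeg := hdegA u huA
    rw [eB_singleton_left G B u hu] at hdeg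
    have hbad := card_bad_partners_le hε (by linarith) hA hB hreg hc hu hdeg
    have hsplit : ((A.filter fun v => u ≠ v ∧ GoodPair G B c ε d u v).card : ℝ) +
        (A.filter fun v => ¬(u ≠ v ∧ GoodPair G B c ε d u v)).card = A.card := by
      exact_mod_cast card_filter_add_card_filter_not _
    have : 0 ≤ ε * A.card := by positivity
    linarith
  have htotal : (1 - 7 * ε) * (A.card : ℝ) ^ 2 ≤ (((A ×ˢ A).filter fun p =>
      p.1 ≠ p.2 ∧ GoodPair G B c ε d p.1 p.2).card : ℝ) := by
    have hsum : ((A ×ˢ A).filter fun p => p.1 ≠ p.2 ∧ GoodPair G B c ε d p.1 p.2).card =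
        ∑ u ∈ A, (A.filter fun v => u ≠ v ∧ GoodPair G B c ε d u v).card := by
      rw [card_filter, sum_product]
      exact sum_congr rfl fun u _ => (card_filter _ _).symm
    rw [hsum]
    push_cast
    calc (1 - 7 * ε) * (A.card : ℝ) ^ 2 = ∑ _u ∈ A, (1 - 7 * ε) * (A.card : ℝ) := by
          rw [sum_const, nsmul_eq_mul]
          ring
      _ ≤ _ := sum_le_sum hrow
  have himage := card_le_two_mul_card_image_sym2 ((A ×ˢ A).filter fun p =>
      p.1 ≠ p.2 ∧ GoodPair G B c ε d p.1 p.2)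
  have himage' : (((A ×ˢ A).filter fun p =>
      p.1 ≠ p.2 ∧ GoodPair G B c ε d p.1 p.2).card : ℝ) ≤
      2 * ((((A ×ˢ A).filter fun p =>
        p.1 ≠ p.2 ∧ GoodPair G B c ε d p.1 p.2).image fun p => s(p.1, p.2)).card : ℝ) := by
    exact_mod_cast himage
  linarith
end
end

section
/- For all γ, d ∈ (0,1] there exist ε₀ > 0 and, for each ε ≤ ε₀, an n₀ ∈ ℕ such that the following holds for all n ≥ n₀. Suppose G is a bipartite graph with vertex partition (A,B) such that |A| = n, γn ≤ |B| ≤ γ⁻¹n, and at least (1-5ε)n²/2 pairs of distinct vertices u, v ∈ A satisfy deg_G(u), deg_G(v) ≥ (d-ε)|B| and |N_G(u) ∩ N_G(v)| ≤ (d+ε)²|B|. Then G is (ε^{1/6}, d)-regular. -/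
open Finset
open scoped Classical

noncomputable section

variable {V : Type*}

/-- The image of a symmetric set of off-diagonal pairs in `Sym2` has at most half its size. -/
lemma two_mul_card_image_sym2_le {α : Type*} (Q : Finset (α × α))
    (hne : ∀ p ∈ Q, p.1 ≠ p.2) (hswap : ∀ p ∈ Q, p.swap ∈ Q) :
    2 * (Q.image fun p => s(p.1, p.2)).card ≤ Q.card := by
  rw [Finset.card_eq_sum_card_image (fun p : α × α => s(p.1, p.2)) Q, mul_comm, ← smul_eq_mul]
  refine Finset.card_nsmul_le_sum _ _ _ fun e he => ?_
  obtain ⟨p, hp, rfl⟩ := Finset.mem_image.1 he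
  have hsub : {p, p.swap} ⊆ Q.filter fun q => s(q.1, q.2) = s(p.1, p.2) := by
    intro q hq
    rcases Finset.mem_insert.1 hq with rfl | hq
    · exact Finset.mem_filter.2 ⟨hp, rfl⟩
    · rw [Finset.mem_singleton] at hq
      subst hq
      exact Finset.mem_filter.2 ⟨hswap p hp, Sym2.eq_swap⟩
  refine le_trans (le_of_eq ?_) (Finset.card_le_card hsub)
  rw [Finset.card_pair]
  intro h
  exact hne p hp (congrArg Prod.fst h)

/-- Second moment bound for the discrepancy of a function on `S × T`. -/
lemma sq_sum_le_card_mul_sum_inner {α β : Type*} (S : Finset α) {T B : Finset β} (hT : T ⊆ B)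
    (y : α → β → ℝ) :
    (∑ u ∈ S, ∑ w ∈ T, y u w) ^ 2 ≤
      T.card * ∑ p ∈ S ×ˢ S, ∑ w ∈ B, y p.1 w * y p.2 w := by
  have hrw : ∑ p ∈ S ×ˢ S, ∑ w ∈ B, y p.1 w * y p.2 w = ∑ w ∈ B, (∑ u ∈ S, y u w) ^ 2 := by
    rw [Finset.sum_comm]
    refine Finset.sum_congr rfl fun w _ => ?_
    rw [sq, Finset.sum_mul_sum, Finset.sum_product]
  rw [hrw, Finset.sum_comm]
  refine sq_sum_le_card_mul_sum_sq.trans ?_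
  gcongr

/-- The sum of the centred adjacency indicators over `S × T` is the edge discrepancy. -/
lemma sum_adj_sub_eq [Fintype V] (G : SimpleGraph V) (S T : Finset V) (d : ℝ) :
    ∑ u ∈ S, ∑ w ∈ T, ((if G.Adj u w then (1 : ℝ) else 0) - d) =
      eB G S T - d * (S.card * T.card) := by
  rw [← Finset.sum_product', Finset.sum_sub_distrib, Finset.sum_boole, Finset.sum_const,
    Finset.card_product, nsmul_eq_mul, eB]
  push_cast
  ring

/-- Centred inner products of adjacency indicators, in terms of degrees and codegrees. -/
lemma sum_adj_sub_mul_adj_sub_eq [Fintype V] (G : SimpleGraph V) (B : Finset V) (d : ℝ) {u v : V}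
    (hu : ∀ w, G.Adj u w → w ∈ B) (hv : ∀ w, G.Adj v w → w ∈ B) :
    ∑ w ∈ B, ((if G.Adj u w then (1 : ℝ) else 0) - d) * ((if G.Adj v w then (1 : ℝ) else 0) - d) =
      ((Finset.univ.filter fun w => G.Adj u w ∧ G.Adj v w).card : ℝ)
        - d * (Finset.univ.filter (G.Adj u)).card - d * (Finset.univ.filter (G.Adj v)).card
        + d ^ 2 * B.card := by
  have key : ∀ (P : V → Prop) [DecidablePred P], (∀ w, P w → w ∈ B) →
      ((Finset.univ.filter P).card : ℝ) = ∑ w ∈ B, if P w then (1 : ℝ) else 0 := by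
    intro P _ hP
    rw [Finset.sum_boole]
    congr 2
    ext w
    simpa using hP w
  rw [key _ hu, key _ hv, key _ fun w hw => hu w hw.1, Finset.mul_sum, Finset.mul_sum,
    ← Finset.sum_sub_distrib, ← Finset.sum_sub_distrib, mul_comm (d ^ 2), ← nsmul_eq_mul,
    ← Finset.sum_const, ← Finset.sum_add_distrib]
  refine Finset.sum_congr rfl fun w _ => ?_
  by_cases h1 : G.Adj u w <;> by_cases h2 : G.Adj v w <;> simp [h1, h2] <;> ring

/-- Centred inner products of adjacency indicators are at most the number of coordinates. -/
lemma sum_adj_sub_mul_adj_sub_le_card (G : SimpleGraph V) (B : Finset V) {d : ℝ}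
    (hd0 : 0 ≤ d) (hd1 : d ≤ 1) (u v : V) :
    ∑ w ∈ B, ((if G.Adj u w then (1 : ℝ) else 0) - d) * ((if G.Adj v w then (1 : ℝ) else 0) - d)
      ≤ B.card := by
  rw [← mul_one (B.card : ℝ), ← nsmul_eq_mul]
  refine Finset.sum_le_card_nsmul _ _ _ fun w _ => ?_
  split_ifs <;> nlinarith

/-- **Theorem (regularity from degrees and codegrees, Duke–Lefmann–Rödl).**
If in a bipartite graph with parts `A` (of size `n`) and `B` (of size between `γn` and
`γ⁻¹n`) at least `(1-5ε)n²/2` (unordered) pairs of distinct vertices `u,v ∈ A` have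
`deg(u), deg(v) ≥ (d-ε)|B|` and `|N(u) ∩ N(v)| ≤ (d+ε)²|B|`, then the graph is
`(ε^{1/6}, d)`-regular. -/
theorem regular_from_codegrees (γ d : ℝ) (hγ0 : 0 < γ) (hγ1 : γ ≤ 1)
    (hd0 : 0 < d) (hd1 : d ≤ 1) :
    ∃ ε₀ > (0 : ℝ), ∀ ε : ℝ, 0 < ε → ε ≤ ε₀ →
    ∃ n₀ : ℕ, ∀ n : ℕ, n₀ ≤ n →
    ∀ (V : Type) [Fintype V],
    ∀ (G : SimpleGraph V) (A B : Finset V),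
      Disjoint A B → A ∪ B = Finset.univ →
      (∀ u v, G.Adj u v → (u ∈ A ∧ v ∈ B) ∨ (u ∈ B ∧ v ∈ A)) →
      A.card = n → γ * n ≤ (B.card : ℝ) → (B.card : ℝ) ≤ γ⁻¹ * n →
      ((1 - 5 * ε) * (n : ℝ) ^ 2 / 2 ≤
        ((((A ×ˢ A).filter fun p => p.1 ≠ p.2 ∧
            (d - ε) * B.card ≤ ((Finset.univ.filter (G.Adj p.1)).card : ℝ) ∧
            (d - ε) * B.card ≤ ((Finset.univ.filter (G.Adj p.2)).card : ℝ) ∧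
            ((Finset.univ.filter fun w => G.Adj p.1 w ∧ G.Adj p.2 w).card : ℝ) ≤
              (d + ε) ^ 2 * B.card).image fun p => s(p.1, p.2)).card : ℝ)) →
      RegularPair G A B (ε ^ ((1 : ℝ) / 6)) d := by
  refine ⟨(1 / 11) ^ 6, by positivity, fun ε hε hε₀ => ⟨1, ?_⟩⟩
  intro n hn V _ G A B hAB _ hbip hA hB _ hgood S hS T hT hSc hTc
  set η : ℝ := ε ^ ((1 : ℝ) / 6) with hη
  have hη0 : 0 < η := Real.rpow_pos_of_pos hε _
  have hη6 : η ^ 6 = ε := by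
    rw [hη, ← Real.rpow_natCast, ← Real.rpow_mul hε.le]
    norm_num
  have hη1 : η ≤ 1 / 11 := by
    rw [← hη6] at hε₀
    exact le_of_pow_le_pow_left₀ (by norm_num) (by norm_num) hε₀
  have hε1 : ε ≤ 1 := hε₀.trans (by norm_num)
  have hn0 : (0 : ℝ) < n := by exact_mod_cast hn
  have hm0 : (0 : ℝ) < B.card := (mul_pos hγ0 hn0).trans_le hB
  rw [hA] at hSc
  have hs0 : (0 : ℝ) < S.card := (mul_pos hη0 hn0).trans_le hSc
  have ht0 : (0 : ℝ) < T.card := (mul_pos hη0 hm0).trans_le hTc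
  have hsn : (S.card : ℝ) ≤ n := by exact_mod_cast hA ▸ Finset.card_le_card hS
  have hnbr : ∀ u ∈ A, ∀ w, G.Adj u w → w ∈ B := by
    intro u hu w huw
    rcases hbip u w huw with h | h
    · exact h.2
    · exact absurd h.1 (Finset.disjoint_left.1 hAB hu)
  set Q := (A ×ˢ A).filter fun p => p.1 ≠ p.2 ∧
            (d - ε) * B.card ≤ ((Finset.univ.filter (G.Adj p.1)).card : ℝ) ∧
            (d - ε) * B.card ≤ ((Finset.univ.filter (G.Adj p.2)).card : ℝ) ∧
            ((Finset.univ.filter fun w => G.Adj p.1 w ∧ G.Adj p.2 w).card : ℝ) ≤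
              (d + ε) ^ 2 * B.card with hQ
  have hQcard : (1 - 5 * ε) * (n : ℝ) ^ 2 ≤ Q.card := by
    have h2 : 2 * (Q.image fun p => s(p.1, p.2)).card ≤ Q.card := by
      refine two_mul_card_image_sym2_le Q (fun p hp => (Finset.mem_filter.1 hp).2.1) ?_
      rintro ⟨u, v⟩ hp
      simp only [hQ, Finset.mem_filter, Finset.mem_product, Prod.swap] at hp ⊢
      obtain ⟨⟨hu, hv⟩, hne, h1, h2, h3⟩ := hp
      refine ⟨⟨hv, hu⟩, hne.symm, h2, h1, ?_⟩
      simpa only [and_comm] using h3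
    have h3 : (2 : ℝ) * (Q.image fun p => s(p.1, p.2)).card ≤ Q.card := by exact_mod_cast h2
    linarith
  have hbad : (((S ×ˢ S) \ Q).card : ℝ) ≤ 5 * ε * (n : ℝ) ^ 2 := by
    have h1 : ((S ×ˢ S) \ Q).card ≤ ((A ×ˢ A) \ Q).card :=
      Finset.card_le_card (Finset.sdiff_subset_sdiff (Finset.product_subset_product hS hS) le_rfl)
    have h2 : ((A ×ˢ A) \ Q).card + Q.card = n * n := by
      rw [Finset.card_sdiff_add_card_eq_card (Finset.filter_subset _ _), Finset.card_product, hA]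
    have h1' : (((S ×ˢ S) \ Q).card : ℝ) ≤ ((A ×ˢ A) \ Q).card := by exact_mod_cast h1
    have h2' : (((A ×ˢ A) \ Q).card : ℝ) + Q.card = n * n := by exact_mod_cast h2
    nlinarith
  have hsum : ∑ p ∈ S ×ˢ S, ∑ w ∈ B, ((if G.Adj p.1 w then (1 : ℝ) else 0) - d) *
      ((if G.Adj p.2 w then (1 : ℝ) else 0) - d) ≤ 10 * ε * n ^ 2 * B.card := by
    have hpt : ∀ p ∈ S ×ˢ S, ∑ w ∈ B, ((if G.Adj p.1 w then (1 : ℝ) else 0) - d) *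
        ((if G.Adj p.2 w then (1 : ℝ) else 0) - d) ≤
          5 * ε * B.card + if p ∉ Q then (B.card : ℝ) else 0 := by
      intro p hp
      by_cases hpQ : p ∈ Q
      · obtain ⟨hpA, -, h1, h2, h3⟩ := Finset.mem_filter.1 hpQ
        rw [Finset.mem_product] at hpA
        rw [sum_adj_sub_mul_adj_sub_eq G B d (hnbr _ hpA.1) (hnbr _ hpA.2)]
        have h1' := mul_le_mul_of_nonneg_left h1 hd0.le
        have h2' := mul_le_mul_of_nonneg_left h2 hd0.le
        have h4 : (4 * d * ε + ε ^ 2) * B.card ≤ 5 * ε * B.card :=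
          mul_le_mul_of_nonneg_right (by nlinarith) hm0.le
        simp only [hpQ, not_true_eq_false, if_false]
        linarith
      · have := sum_adj_sub_mul_adj_sub_le_card G B hd0.le hd1 p.1 p.2
        have h5 : 0 ≤ 5 * ε * B.card := by positivity
        simp only [hpQ, not_false_eq_true, if_true]
        linarith
    refine (Finset.sum_le_sum hpt).trans ?_
    rw [Finset.sum_add_distrib, Finset.sum_const, ← Finset.sum_filter, Finset.sum_const,
      Finset.filter_notMem_eq_sdiff, Finset.card_product, nsmul_eq_mul, nsmul_eq_mul]
    push_cast
    have h6 : (S.card : ℝ) * S.card * (5 * ε * B.card) ≤ n * n * (5 * ε * B.card) := by gcongr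
    have h7 := mul_le_mul_of_nonneg_right hbad hm0.le
    linarith
  have hsq := sq_sum_le_card_mul_sum_inner S hT
    fun u w => (if G.Adj u w then (1 : ℝ) else 0) - d
  rw [sum_adj_sub_eq] at hsq
  have hst : (0 : ℝ) < S.card * T.card := mul_pos hs0 ht0
  have hdens : (eB G S T : ℝ) / (S.card * T.card) - d =
      (eB G S T - d * (S.card * T.card)) / (S.card * T.card) := by
    field_simp
  rw [hdens, abs_div, abs_of_pos hst, div_le_iff₀ hst]
  refine abs_le_of_sq_le_sq (hsq.trans ?_) (by positivity)
  have hs2 : (η * n) ^ 2 ≤ (S.card : ℝ) ^ 2 := by gcongr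
  calc (T.card : ℝ) * _ ≤ T.card * (10 * ε * n ^ 2 * B.card) := by gcongr
    _ = T.card * (10 * η) * (η ^ 2 * ((η * n) ^ 2 * (η * B.card))) := by rw [← hη6]; ring
    _ ≤ T.card * 1 * (η ^ 2 * ((S.card : ℝ) ^ 2 * T.card)) := by
        gcongr
        linarith
    _ = (η * (S.card * T.card)) ^ 2 := by ring
end
end

section
/- For all d ∈ (0,1] there exist ε₀ > 0 and, for each ε ≤ ε₀, an n₀ ∈ ℕ such that the following holds for all n ≥ n₀. Let G be an (ε,d)-super-regular bipartite graph with partition (A,B), where ε^{1/6}·n ≤ |A|, |B| ≤ n. If H is a graph with Δ(H) ≤ εn and X ⊆ A ∪ B with |X| ≤ εn, then the graph obtained from G by deleting the vertices of X and the edges of H, namely G[A∖X, B∖X] − E(H), is (ε^{1/3}, d)-super-regular. -/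
open Finset
open scoped Classical

noncomputable section

variable {V : Type*}

theorem eB_comm [Fintype V] (G : SimpleGraph V) (S T : Finset V) : eB G S T = eB G T S := by
  unfold eB
  refine Finset.card_bij' (fun p _ => p.swap) (fun p _ => p.swap) ?_ ?_ ?_ ?_ <;>
    simp +contextual [G.adj_comm]

theorem eB_sdiff_le [Fintype V] (G H : SimpleGraph V) (S T : Finset V) :
    eB (G \ H) S T ≤ eB G S T := by
  refine Finset.card_le_card fun p hp => ?_
  simp only [Finset.mem_filter, SimpleGraph.sdiff_adj] at hp ⊢
  exact ⟨hp.1, hp.2.1⟩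

theorem eB_le_eB_sdiff_add [Fintype V] (G H : SimpleGraph V) (S T : Finset V) :
    eB G S T ≤ eB (G \ H) S T + eB H S T := by
  refine le_trans (Finset.card_le_card fun p hp => ?_) (Finset.card_union_le _ _)
  simp only [Finset.mem_union, Finset.mem_filter, SimpleGraph.sdiff_adj] at hp ⊢
  tauto

theorem eB_sdiff_right_le [Fintype V] (G : SimpleGraph V) (S T X : Finset V) :
    eB G S (T \ X) ≤ eB G S T := by
  refine Finset.card_le_card fun p hp => ?_
  simp only [Finset.mem_filter, Finset.mem_product, Finset.mem_sdiff] at hp ⊢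
  tauto

theorem eB_le_eB_sdiff_right_add [Fintype V] (G : SimpleGraph V) (S T X : Finset V) :
    eB G S T ≤ eB G S (T \ X) + S.card * X.card := by
  rw [← Finset.card_product]
  refine le_trans (Finset.card_le_card fun p hp => ?_) (Finset.card_union_le _ _)
  simp only [Finset.mem_union, Finset.mem_filter, Finset.mem_product, Finset.mem_sdiff] at hp ⊢
  tauto

theorem eB_le_card_mul [Fintype V] (H : SimpleGraph V) (S T : Finset V) {k : ℝ}
    (hk : ∀ v, ((Finset.univ.filter (H.Adj v)).card : ℝ) ≤ k) :
    (eB H S T : ℝ) ≤ S.card * k := by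
  have h : eB H S T ≤ ∑ v ∈ S, (Finset.univ.filter (H.Adj v)).card := by
    rw [← Finset.card_sigma]
    refine Finset.card_le_card_of_injOn (fun p => ⟨p.1, p.2⟩) ?_ ?_
    · intro p hp
      simp only [Finset.coe_filter, Finset.mem_product, Set.mem_ofPred_eq] at hp
      simp [hp.1.1, hp.2]
    · rintro ⟨a, b⟩ - ⟨c, e⟩ - h
      simpa using h
  calc (eB H S T : ℝ) ≤ ∑ v ∈ S, ((Finset.univ.filter (H.Adj v)).card : ℝ) := by
        exact_mod_cast h
    _ ≤ ∑ _v ∈ S, k := Finset.sum_le_sum fun v _ => hk v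
    _ = S.card * k := by simp

theorem card_le_card_sdiff_add_card_real (B X : Finset V) :
    (B.card : ℝ) ≤ (B \ X).card + X.card := by
  exact_mod_cast Finset.card_le_card_sdiff_add_card

/-- If at most `t ^ 6 * n` elements are removed from a set of size at least `t * n`, at least
the proportion `1 - t ^ 5` remains. -/
theorem one_sub_mul_card_le_card_sdiff {B X : Finset V} {t n : ℝ} (ht : 0 < t)
    (hB : t * n ≤ B.card) (hX : (X.card : ℝ) ≤ t ^ 6 * n) :
    (1 - t ^ 5) * B.card ≤ (B \ X).card := by
  have h₁ := card_le_card_sdiff_add_card_real B X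
  have h₂ := mul_le_mul_of_nonneg_left hB (pow_nonneg ht.le 5)
  linarith

theorem abs_eB_sdiff_singleton_sub_le [Fintype V] (G H : SimpleGraph V) (v : V)
    (B X : Finset V) {t n d : ℝ} (ht : 0 < t) (ht' : t ≤ 1 / 2) (hd0 : 0 ≤ d) (hd1 : d ≤ 1)
    (hB : t * n ≤ B.card) (hX : (X.card : ℝ) ≤ t ^ 6 * n)
    (hH : ∀ v, ((Finset.univ.filter (H.Adj v)).card : ℝ) ≤ t ^ 6 * n)
    (hG : |(eB G {v} B : ℝ) - d * B.card| ≤ t ^ 6 * B.card) :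
    |(eB (G \ H) {v} (B \ X) : ℝ) - d * (B \ X).card| ≤ t ^ 2 * (B \ X).card := by
  have hcard := card_le_card_sdiff_add_card_real B X
  have hle : ((B \ X).card : ℝ) ≤ B.card := by
    exact_mod_cast Finset.card_le_card Finset.sdiff_subset
  have hB' := mul_le_mul_of_nonneg_left hB (pow_nonneg ht.le 5)
  have hrem := one_sub_mul_card_le_card_sdiff ht hB hX
  have h₁ : (eB (G \ H) {v} (B \ X) : ℝ) ≤ eB G {v} (B \ X) := by
    exact_mod_cast eB_sdiff_le G H _ _
  have h₂ : (eB G {v} (B \ X) : ℝ) ≤ eB (G \ H) {v} (B \ X) + eB H {v} (B \ X) := by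
    exact_mod_cast eB_le_eB_sdiff_add G H _ _
  have h₃ : (eB G {v} (B \ X) : ℝ) ≤ eB G {v} B := by
    exact_mod_cast eB_sdiff_right_le G _ _ _
  have h₄ : (eB G {v} B : ℝ) ≤ eB G {v} (B \ X) + X.card := by
    have := eB_le_eB_sdiff_right_add G {v} B X
    rw [Finset.card_singleton, one_mul] at this
    exact_mod_cast this
  have h₅ := eB_le_card_mul H {v} (B \ X) hH
  rw [Finset.card_singleton, Nat.cast_one, one_mul] at h₅
  have hd₁ : d * (B \ X).card ≤ d * B.card := mul_le_mul_of_nonneg_left hle hd0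
  have hd₂ : d * B.card ≤ d * (B \ X).card + X.card := by
    have := mul_le_mul_of_nonneg_left hcard hd0
    have := mul_le_of_le_one_left (Nat.cast_nonneg (α := ℝ) X.card) hd1
    linarith
  have ht3 : t ^ 3 ≤ 1 / 8 := by
    calc t ^ 3 ≤ (1 / 2) ^ 3 := by gcongr
      _ = 1 / 8 := by norm_num
  have hcoef : t ^ 6 + 2 * t ^ 5 ≤ t ^ 2 * (1 - t ^ 5) := by
    have h4 : t ^ 4 ≤ 1 / 16 := by
      calc t ^ 4 ≤ (1 / 2) ^ 4 := by gcongr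
        _ = 1 / 16 := by norm_num
    have h5 : t ^ 5 ≤ 1 / 32 := by
      calc t ^ 5 ≤ (1 / 2) ^ 5 := by gcongr
        _ = 1 / 32 := by norm_num
    have : t ^ 2 * (t ^ 4 + 2 * t ^ 3) ≤ t ^ 2 * (1 - t ^ 5) := by
      gcongr
      linarith
    linarith
  have hfin : (t ^ 6 + 2 * t ^ 5) * B.card ≤ t ^ 2 * (B \ X).card := by
    calc (t ^ 6 + 2 * t ^ 5) * B.card ≤ t ^ 2 * (1 - t ^ 5) * B.card := by gcongr
      _ = t ^ 2 * ((1 - t ^ 5) * B.card) := by ring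
      _ ≤ t ^ 2 * (B \ X).card := by gcongr
  rw [abs_le] at hG ⊢
  constructor <;> linarith [hG.1, hG.2]

theorem RegularPair.sdiff [Fintype V] {G H : SimpleGraph V} {A B X : Finset V} {t n d : ℝ}
    (ht : 0 < t) (ht' : t ≤ 1 / 2) (hn : 0 < n)
    (hA : t * n ≤ A.card) (hB : t * n ≤ B.card) (hX : (X.card : ℝ) ≤ t ^ 6 * n)
    (hH : ∀ v, ((Finset.univ.filter (H.Adj v)).card : ℝ) ≤ t ^ 6 * n)
    (hG : RegularPair G A B (t ^ 6) d) :
    RegularPair (G \ H) (A \ X) (B \ X) (t ^ 2) d := by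
  intro S hS T hT hSc hTc
  have h3 : t ^ 3 ≤ 1 / 8 := by
    calc t ^ 3 ≤ (1 / 2) ^ 3 := by gcongr
      _ = 1 / 8 := by norm_num
  have h4 : t ^ 4 ≤ 1 / 16 := by
    calc t ^ 4 ≤ (1 / 2) ^ 4 := by gcongr
      _ = 1 / 16 := by norm_num
  have h5 : t ^ 5 ≤ 1 / 32 := by
    calc t ^ 5 ≤ (1 / 2) ^ 5 := by gcongr
      _ = 1 / 32 := by norm_num
  have hlarge : ∀ {C R : Finset V}, t * n ≤ C.card → t ^ 2 * (C \ X).card ≤ R.card →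
      31 / 32 * t ^ 2 * C.card ≤ R.card := fun {C R} hC hR => by
    calc 31 / 32 * t ^ 2 * (C.card : ℝ) ≤ (1 - t ^ 5) * t ^ 2 * C.card := by
          gcongr
          linarith
      _ = t ^ 2 * ((1 - t ^ 5) * C.card) := by ring
      _ ≤ t ^ 2 * (C \ X).card := by
          gcongr
          exact one_sub_mul_card_le_card_sdiff ht hC hX
      _ ≤ R.card := hR
  have hsmall : t ^ 6 ≤ 31 / 32 * t ^ 2 := by
    calc t ^ 6 = t ^ 4 * t ^ 2 := by ring
      _ ≤ 31 / 32 * t ^ 2 := by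
          gcongr
          linarith
  have hS' := hlarge hA hSc
  have hT' := hlarge hB hTc
  have hApos : (0 : ℝ) < A.card := (mul_pos ht hn).trans_le hA
  have hBpos : (0 : ℝ) < B.card := (mul_pos ht hn).trans_le hB
  have hSpos : (0 : ℝ) < S.card := lt_of_lt_of_le (by positivity) hS'
  have hTpos : (0 : ℝ) < T.card := lt_of_lt_of_le (by positivity) hT'
  have hreg := hG S (hS.trans Finset.sdiff_subset) T (hT.trans Finset.sdiff_subset)
    ((mul_le_mul_of_nonneg_right hsmall hApos.le).trans hS')
    ((mul_le_mul_of_nonneg_right hsmall hBpos.le).trans hT')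
  have h₁ : (eB (G \ H) S T : ℝ) ≤ eB G S T := by
    exact_mod_cast eB_sdiff_le G H S T
  have h₂ : (eB G S T : ℝ) ≤ eB (G \ H) S T + eB H S T := by
    exact_mod_cast eB_le_eB_sdiff_add G H S T
  have hprod : (0 : ℝ) < S.card * T.card := mul_pos hSpos hTpos
  have hHd : (eB H S T : ℝ) / (S.card * T.card) ≤ 32 / 31 * t ^ 3 := by
    rw [div_le_iff₀ hprod]
    have hTn : t ^ 6 * n ≤ 32 / 31 * t ^ 3 * T.card := by
      calc t ^ 6 * n = 32 / 31 * t ^ 3 * (31 / 32 * t ^ 2 * (t * n)) := by ring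
        _ ≤ 32 / 31 * t ^ 3 * (31 / 32 * t ^ 2 * B.card) := by gcongr
        _ ≤ 32 / 31 * t ^ 3 * T.card := by gcongr
    calc (eB H S T : ℝ) ≤ S.card * (t ^ 6 * n) := eB_le_card_mul H S T hH
      _ ≤ S.card * (32 / 31 * t ^ 3 * T.card) := by gcongr
      _ = 32 / 31 * t ^ 3 * (S.card * T.card) := by ring
  have hd₁ : (eB (G \ H) S T : ℝ) / (S.card * T.card) ≤ eB G S T / (S.card * T.card) := by
    gcongr
  have hd₂ : (eB G S T : ℝ) / (S.card * T.card) ≤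
      eB (G \ H) S T / (S.card * T.card) + eB H S T / (S.card * T.card) := by
    rw [← add_div]
    gcongr
  have hcoef : t ^ 6 + 32 / 31 * t ^ 3 ≤ t ^ 2 := by
    calc t ^ 6 + 32 / 31 * t ^ 3 = t ^ 2 * (t ^ 4 + 32 / 31 * t) := by ring
      _ ≤ t ^ 2 * 1 := by
          gcongr
          linarith
      _ = t ^ 2 := mul_one _
  have ht3 : 0 < t ^ 3 := by positivity
  rw [abs_le] at hreg ⊢
  constructor <;> linarith [hreg.1, hreg.2]

/-- **Fact (robustness of super-regularity).**
Super-regularity survives deleting at most `εn` vertices and the edges of a graph of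
maximum degree at most `εn`: the resulting pair is `(ε^{1/3},d)`-super-regular. -/
theorem superregularity_robust (d : ℝ) (hd0 : 0 < d) (hd1 : d ≤ 1) :
    ∃ ε₀ > (0 : ℝ), ∀ ε : ℝ, 0 < ε → ε ≤ ε₀ →
    ∃ n₀ : ℕ, ∀ n : ℕ, n₀ ≤ n →
    ∀ (V : Type) [Fintype V],
    ∀ (G : SimpleGraph V) (A B : Finset V),
      Disjoint A B → A ∪ B = Finset.univ →
      (∀ u v, G.Adj u v → (u ∈ A ∧ v ∈ B) ∨ (u ∈ B ∧ v ∈ A)) →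
      SuperRegularPair G A B ε d →
      ε ^ ((1 : ℝ) / 6) * n ≤ (A.card : ℝ) → (A.card : ℝ) ≤ n →
      ε ^ ((1 : ℝ) / 6) * n ≤ (B.card : ℝ) → (B.card : ℝ) ≤ n →
      ∀ H : SimpleGraph V,
        (∀ v, (((Finset.univ.filter (H.Adj v)).card : ℝ) ≤ ε * n)) →
      ∀ X : Finset V, X ⊆ A ∪ B → (X.card : ℝ) ≤ ε * n →
      SuperRegularPair (G \ H) (A \ X) (B \ X) (ε ^ ((1 : ℝ) / 3)) d := by
  refine ⟨(1 / 2) ^ 6, by positivity, fun ε hε hε₀ => ⟨1, ?_⟩⟩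
  intro n hn V _ G A B _ _ _ hG hA _ hB _ H hH X _ hX
  obtain ⟨hreg, hdegA, hdegB⟩ := hG
  set t : ℝ := ε ^ ((1 : ℝ) / 6) with ht_def
  have ht : 0 < t := Real.rpow_pos_of_pos hε _
  have ht6 : t ^ 6 = ε := by
    rw [ht_def, ← Real.rpow_natCast, ← Real.rpow_mul hε.le]
    norm_num
  have ht2 : ε ^ ((1 : ℝ) / 3) = t ^ 2 := by
    rw [ht_def, ← Real.rpow_natCast, ← Real.rpow_mul hε.le]
    norm_num
  have ht' : t ≤ 1 / 2 :=
    le_of_pow_le_pow_left₀ (n := 6) (by norm_num) (by norm_num) (ht6.trans_le hε₀)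
  have hn' : (0 : ℝ) < n := by exact_mod_cast hn
  rw [ht2]
  rw [← ht6] at hreg hdegA hdegB hH hX
  refine ⟨hreg.sdiff ht ht' hn' hA hB hX hH, fun a ha => ?_, fun b hb => ?_⟩
  · exact abs_eB_sdiff_singleton_sub_le G H a B X ht ht' hd0.le hd1 hB hX hH
      (hdegA a (Finset.mem_sdiff.1 ha).1)
  · rw [eB_comm]
    refine abs_eB_sdiff_singleton_sub_le G H b A X ht ht' hd0.le hd1 hA hX hH ?_
    rw [eB_comm]
    exact hdegB b (Finset.mem_sdiff.1 hb).1
end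
end
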